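/- arXiv:1701.02076 — 2 statements merged into one kernel-verified Lean document; each statement's English description precedes it below -/
import Mathlib

section
/- For every Coxeter group W there exists a ℤ-linear anti-automorphism x ↦ x̄ of Ĥ(W) (bijective, additive, with 1̄ = 1 and x·y ↦ ȳ·x̄) satisfying s̄_i = s_i and D̄_i = D_i for all i ∈ I, and it is an involution (x̄̄ = x). Moreover it preserves the Hopf ideal J(W), hence induces an involutive anti-automorphism of the lower Hecke–Hopf algebra H̲(W) = Ĥ(W)/J(W) fixing the images of all s_i and D_i. -/
open scoped TensorProduct

namespace HeckeHopfCox

/-- Generators of `Ĥ(W)`: `s i` and `D i` for `i ∈ I`. -/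
inductive Gen (B : Type*) : Type _
  | s : B → Gen B
  | D : B → Gen B

/-- The free `ℤ`-algebra on the generators. -/
abbrev F (B : Type*) : Type _ := FreeAlgebra ℤ (Gen B)

noncomputable def fs {B : Type*} (i : B) : F B := FreeAlgebra.ι ℤ (Gen.s i)
noncomputable def fD {B : Type*} (i : B) : F B := FreeAlgebra.ι ℤ (Gen.D i)

/-- The alternating word `sᵢ sⱼ sᵢ ⋯` with `k` factors, starting with `sᵢ`. -/
noncomputable def altS {B : Type*} (i j : B) : ℕ → F B
  | 0 => 1
  | k + 1 => fs i * altS j i k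

/-- The defining relations of `Ĥ(W)`: (i) rank-one relations; (ii) Coxeter relations;
(iii) the linear braid relations `Dᵢ·(sⱼsᵢ⋯s_{j'}) = (sⱼ⋯s_{i'}s_{j'})·D_{i'}`, where the
alternating word has `m_{ij} - 1` factors starting with `sⱼ`, and `i' = i` if `m_{ij}` is
even and `i' = j` if `m_{ij}` is odd. -/
inductive Rel {B : Type*} (M : CoxeterMatrix B) : F B → F B → Prop
  | s_sq (i : B) : Rel M (fs i * fs i) 1
  | D_sq (i : B) : Rel M (fD i * fD i) (fD i)
  | sD (i : B) : Rel M (fs i * fD i + fD i * fs i) (fs i - 1)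
  | coxeter (i j : B) : Rel M ((fs i * fs j) ^ M i j) 1
  | braidLin (i j : B) : i ≠ j → M i j ≠ 0 →
      Rel M (fD i * altS j i (M i j - 1))
        (altS j i (M i j - 1) * fD (if M i j % 2 = 0 then i else j))

/-- The algebra `Ĥ(W)` associated to a Coxeter matrix. -/
abbrev HW {B : Type*} (M : CoxeterMatrix B) : Type _ := RingQuot (Rel M)

/-- The image of the generator `sᵢ` in `Ĥ(W)`. -/
noncomputable def hs {B : Type*} (M : CoxeterMatrix B) (i : B) : HW M :=
  RingQuot.mkAlgHom ℤ (Rel M) (fs i)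

/-- The image of the generator `Dᵢ` in `Ĥ(W)`. -/
noncomputable def hD {B : Type*} (M : CoxeterMatrix B) (i : B) : HW M :=
  RingQuot.mkAlgHom ℤ (Rel M) (fD i)

/-- The set of reflections of the Coxeter group `W`, as a subtype. -/
abbrev Refl {B : Type*} (M : CoxeterMatrix B) : Type _ :=
  {t : M.Group // M.toCoxeterSystem.IsReflection t}

/-- `K(W) = ⋂_w π(w)·D̂(W)·π(w)⁻¹`, where `D̂(W)` is the subalgebra generated by the
family `(D_s)_{s ∈ 𝒮}`. -/
def KW {B : Type*} (M : CoxeterMatrix B) (π : M.Group →* (HW M)ˣ)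
    (Dfam : Refl M → HW M) : Set (HW M) :=
  {x | ∀ w : M.Group,
    ((π w : (HW M)ˣ) : HW M) * x * (((π w)⁻¹ : (HW M)ˣ) : HW M) ∈
      Algebra.adjoin ℤ (Set.range Dfam)}

/-- The relation presenting the quotient of `Ĥ(W)` by the two-sided ideal generated by
`K(W) ∩ ker ε`; its `RingQuot` is the lower Hecke-Hopf algebra `H̲(W)`. -/
def lowRel {B : Type*} (M : CoxeterMatrix B) (π : M.Group →* (HW M)ˣ)
    (Dfam : Refl M → HW M) (ε : HW M →ₐ[ℤ] ℤ) : HW M → HW M → Prop :=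
  fun x y => x ∈ KW M π Dfam ∧ ε x = 0 ∧ y = 0

/-- The lower Hecke-Hopf algebra `H̲(W) = Ĥ(W)/J(W)`. -/
abbrev HWlow {B : Type*} (M : CoxeterMatrix B) (π : M.Group →* (HW M)ˣ)
    (Dfam : Refl M → HW M) (ε : HW M →ₐ[ℤ] ℤ) : Type _ :=
  RingQuot (lowRel M π Dfam ε)

/-- The two-sided ideal `J(W)` generated by `K(W) ∩ ker ε`, as a `ℤ`-submodule. -/
def JW {B : Type*} (M : CoxeterMatrix B) (π : M.Group →* (HW M)ˣ)
    (Dfam : Refl M → HW M) (ε : HW M →ₐ[ℤ] ℤ) : Submodule ℤ (HW M) :=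
  Submodule.span ℤ
    {y | ∃ a kk b : HW M, kk ∈ KW M π Dfam ∧ ε kk = 0 ∧ y = a * kk * b}

section Alternating

variable {B : Type*}

theorem altS_succ_right (i j : B) (k : ℕ) :
    altS i j (k + 1) = altS i j k * fs (if k % 2 = 0 then i else j) := by
  induction k generalizing i j with
  | zero => simp [altS]
  | succ k ih =>
    rw [altS, ih j i, ← mul_assoc, ← altS]
    congr 2
    rcases Nat.mod_two_eq_zero_or_one k with h | h
    · rw [if_pos h, if_neg (by lia)]
    · rw [if_neg (by lia), if_pos (by lia)]

end Alternating

section Bar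

open MulOpposite

variable {B : Type*} (M : CoxeterMatrix B)

theorem mk_eq_of_rel {x y : F B} (h : Rel M x y) :
    RingQuot.mkAlgHom ℤ (Rel M) x = RingQuot.mkAlgHom ℤ (Rel M) y :=
  RingQuot.mkAlgHom_rel ℤ h

/-- The map from the free algebra to the opposite of `Ĥ(W)` fixing the generators. -/
noncomputable def preBar : F B →ₐ[ℤ] (HW M)ᵐᵒᵖ :=
  FreeAlgebra.lift ℤ fun
    | .s i => op (hs M i)
    | .D i => op (hD M i)

@[simp] theorem preBar_fs (i : B) : preBar M (fs i) = op (hs M i) := by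
  simp [preBar, fs]

@[simp] theorem preBar_fD (i : B) : preBar M (fD i) = op (hD M i) := by
  simp [preBar, fD]

theorem preBar_altS (i j : B) (k : ℕ) :
    preBar M (altS i j k) =
      op (RingQuot.mkAlgHom ℤ (Rel M) (if k % 2 = 0 then altS j i k else altS i j k)) := by
  induction k generalizing i j with
  | zero => simp [altS]
  | succ k ih =>
    rw [altS, map_mul, ih, preBar_fs, ← op_mul, hs, ← map_mul]
    congr 2
    rcases Nat.mod_two_eq_zero_or_one k with h | h
    · rw [if_pos h, if_neg (by lia), ← altS, altS_succ_right, if_pos h]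
    · rw [if_neg (by lia), if_pos (by lia), altS_succ_right, if_neg (by lia)]

theorem preBar_rel ⦃x y : F B⦄ (h : Rel M x y) : preBar M x = preBar M y := by
  cases h with
  | s_sq i =>
    simpa [← op_mul, hs] using mk_eq_of_rel M (Rel.s_sq i)
  | D_sq i =>
    simpa [← op_mul, hD] using mk_eq_of_rel M (Rel.D_sq i)
  | sD i =>
    have := mk_eq_of_rel M (Rel.sD i)
    simp only [map_add, map_mul, map_sub, map_one, preBar_fs, preBar_fD] at this ⊢
    rw [← op_mul, ← op_mul, ← op_add, ← op_one, ← op_sub, add_comm]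
    exact congrArg op this
  | coxeter i j =>
    have := mk_eq_of_rel M (Rel.coxeter j i)
    rw [M.symmetric j i] at this
    simp only [map_mul, map_pow, map_one, preBar_fs] at this ⊢
    rw [← op_mul, ← op_pow, ← op_one]
    exact congrArg op this
  | braidLin i j hij hm =>
    rcases Nat.mod_two_eq_zero_or_one (M i j) with h | h
    · have := mk_eq_of_rel M (Rel.braidLin i j hij hm)
      rw [if_pos h, map_mul, map_mul] at this
      rw [if_pos h, map_mul, map_mul, preBar_altS, if_neg (by lia), preBar_fD, ← op_mul,
        ← op_mul]
      exact congrArg op this.symm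
    · have := mk_eq_of_rel M (Rel.braidLin j i hij.symm (by rwa [M.symmetric j i]))
      rw [M.symmetric j i, if_neg (by lia), map_mul, map_mul] at this
      rw [if_neg (by lia), map_mul, map_mul, preBar_altS, if_pos (by lia), preBar_fD,
        preBar_fD, ← op_mul, ← op_mul]
      exact congrArg op this.symm

/-- The bar map, as a homomorphism from `Ĥ(W)` to its opposite algebra. -/
noncomputable def barHom : HW M →ₐ[ℤ] (HW M)ᵐᵒᵖ :=
  RingQuot.liftAlgHom ℤ ⟨preBar M, preBar_rel M⟩

@[simp] theorem barHom_hs (i : B) : barHom M (hs M i) = op (hs M i) := by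
  conv_lhs => rw [barHom, hs, RingQuot.liftAlgHom_mkAlgHom_apply]
  exact preBar_fs M i

@[simp] theorem barHom_hD (i : B) : barHom M (hD M i) = op (hD M i) := by
  conv_lhs => rw [barHom, hD, RingQuot.liftAlgHom_mkAlgHom_apply]
  exact preBar_fD M i

theorem HW_algHom_ext {A : Type*} [Ring A] {f g : HW M →ₐ[ℤ] A}
    (hfs : ∀ i, f (hs M i) = g (hs M i)) (hfD : ∀ i, f (hD M i) = g (hD M i)) : f = g := by
  apply RingQuot.ringQuot_ext'
  apply FreeAlgebra.hom_ext
  funext b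
  cases b with
  | s i => exact hfs i
  | D i => exact hfD i

theorem barHom_barHom (x : HW M) : unop (barHom M (unop (barHom M x))) = x := by
  have : (AlgHom.opComm (barHom M)).comp (barHom M) = AlgHom.id ℤ (HW M) := by
    apply HW_algHom_ext <;> intro i
    · change unop (barHom M (unop (barHom M (hs M i)))) = hs M i
      simp
    · change unop (barHom M (unop (barHom M (hD M i)))) = hD M i
      simp
  exact DFunLike.congr_fun this x

/-- The bar involution of `Ĥ(W)`. -/
noncomputable def bar : HW M ≃+ HW M where
  toFun x := unop (barHom M x)
  invFun x := unop (barHom M x)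
  left_inv := barHom_barHom M
  right_inv := barHom_barHom M
  map_add' x y := by simp

theorem bar_apply (x : HW M) : bar M x = unop (barHom M x) := rfl

@[simp] theorem bar_bar (x : HW M) : bar M (bar M x) = x := barHom_barHom M x

@[simp] theorem bar_one : bar M 1 = 1 := by simp [bar_apply]

@[simp] theorem bar_mul (x y : HW M) : bar M (x * y) = bar M y * bar M x := by
  simp [bar_apply]

@[simp] theorem bar_hs (i : B) : bar M (hs M i) = hs M i := by simp [bar_apply]

@[simp] theorem bar_hD (i : B) : bar M (hD M i) = hD M i := by simp [bar_apply]

theorem counit_bar (ε : HW M →ₐ[ℤ] ℤ) (x : HW M) : ε (bar M x) = ε x := by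
  have : (AlgHom.fromOpposite ε fun _ _ => Commute.all _ _).comp (barHom M) = ε := by
    apply HW_algHom_ext <;> intro i <;> simp
  exact DFunLike.congr_fun this x

variable {M} {π : M.Group →* (HW M)ˣ} {Dfam : Refl M → HW M}

theorem bar_group
    (hπ : ∀ i : B, ((π (M.toCoxeterSystem.simple i) : (HW M)ˣ) : HW M) = hs M i)
    (w : M.Group) : bar M (π w : (HW M)ˣ) = ((π w)⁻¹ : (HW M)ˣ) := by
  induction w using M.toCoxeterSystem.simple_induction with
  | simple i => rw [← map_inv, M.toCoxeterSystem.inv_simple, hπ, bar_hs]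
  | one => simp
  | mul v w hv hw => simp [hv, hw]

theorem bar_group_inv
    (hπ : ∀ i : B, ((π (M.toCoxeterSystem.simple i) : (HW M)ˣ) : HW M) = hs M i)
    (w : M.Group) : bar M ((π w)⁻¹ : (HW M)ˣ) = (π w : (HW M)ˣ) := by
  rw [← bar_group hπ, bar_bar]

theorem bar_reflection
    (hD1 : ∀ (i : B) (h : M.toCoxeterSystem.IsReflection (M.toCoxeterSystem.simple i)),
      Dfam ⟨M.toCoxeterSystem.simple i, h⟩ = hD M i)
    (hD2 : ∀ (i : B) (t : Refl M),
      (t : M.Group) ≠ M.toCoxeterSystem.simple i →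
      ∀ h : M.toCoxeterSystem.IsReflection
          (M.toCoxeterSystem.simple i * (t : M.Group) * M.toCoxeterSystem.simple i),
        hs M i * Dfam t * hs M i =
          Dfam ⟨M.toCoxeterSystem.simple i * (t : M.Group) * M.toCoxeterSystem.simple i, h⟩)
    (t : Refl M) : bar M (Dfam t) = Dfam t := by
  obtain ⟨t, ht⟩ := t
  have ht' := ht
  obtain ⟨w, i, rfl⟩ := ht'
  induction w using M.toCoxeterSystem.simple_induction_left with
  | one =>
    have key : ∀ (t : M.Group) (ht : M.toCoxeterSystem.IsReflection t),
        t = M.toCoxeterSystem.simple i → bar M (Dfam ⟨t, ht⟩) = Dfam ⟨t, ht⟩ := by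
      rintro t ht rfl
      rw [hD1, bar_hD]
    exact key _ ht (by simp)
  | mul_simple_left w j ih =>
    have hr : M.toCoxeterSystem.IsReflection (w * M.toCoxeterSystem.simple i * w⁻¹) :=
      ⟨w, i, rfl⟩
    have key : ∀ (t u : M.Group) (ht : M.toCoxeterSystem.IsReflection t)
        (hu : M.toCoxeterSystem.IsReflection u),
        u = M.toCoxeterSystem.simple j * t * M.toCoxeterSystem.simple j →
        bar M (Dfam ⟨t, ht⟩) = Dfam ⟨t, ht⟩ → bar M (Dfam ⟨u, hu⟩) = Dfam ⟨u, hu⟩ := by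
      rintro t u ht hu rfl hfix
      by_cases htj : t = M.toCoxeterSystem.simple j
      · subst htj
        simpa only [M.toCoxeterSystem.simple_mul_simple_self, one_mul] using hfix
      · rw [← hD2 j ⟨t, ht⟩ htj hu]
        simp [hfix, mul_assoc]
    exact key _ _ hr ht (by rw [mul_inv_rev, M.toCoxeterSystem.inv_simple]; simp only [mul_assoc]) (ih hr)

theorem bar_mem_adjoin (hbar : ∀ t, bar M (Dfam t) = Dfam t) {x : HW M}
    (hx : x ∈ Algebra.adjoin ℤ (Set.range Dfam)) :
    bar M x ∈ Algebra.adjoin ℤ (Set.range Dfam) := by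
  induction hx using Algebra.adjoin_induction with
  | mem x hx =>
    obtain ⟨t, rfl⟩ := hx
    rw [hbar]
    exact Algebra.subset_adjoin ⟨t, rfl⟩
  | algebraMap r =>
    rw [bar_apply, AlgHom.commutes]
    exact Subalgebra.algebraMap_mem _ r
  | add x y _ _ hx hy =>
    rw [map_add]
    exact add_mem hx hy
  | mul x y _ _ hx hy =>
    rw [bar_mul]
    exact mul_mem hy hx

theorem bar_mem_KW
    (hπ : ∀ i : B, ((π (M.toCoxeterSystem.simple i) : (HW M)ˣ) : HW M) = hs M i)
    (hbar : ∀ t, bar M (Dfam t) = Dfam t) {x : HW M} (hx : x ∈ KW M π Dfam) :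
    bar M x ∈ KW M π Dfam := by
  intro w
  have := bar_mem_adjoin hbar (hx w)
  rwa [bar_mul, bar_mul, bar_group hπ, bar_group_inv hπ, ← mul_assoc] at this

theorem bar_mem_JW {ε : HW M →ₐ[ℤ] ℤ} (hK : ∀ x ∈ KW M π Dfam, bar M x ∈ KW M π Dfam)
    {x : HW M} (hx : x ∈ JW M π Dfam ε) : bar M x ∈ JW M π Dfam ε := by
  induction hx using Submodule.span_induction with
  | mem x hx =>
    obtain ⟨a, k, b, hk, hε, rfl⟩ := hx
    refine Submodule.subset_span ⟨bar M b, bar M k, bar M a, hK k hk, ?_, ?_⟩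
    · rw [counit_bar, hε]
    · rw [bar_mul, bar_mul, mul_assoc]
  | zero => simp
  | add x y _ _ hx hy =>
    rw [map_add]
    exact add_mem hx hy
  | smul r x _ hx =>
    rw [map_zsmul]
    exact Submodule.smul_mem _ r hx

end Bar

section Quotient

open MulOpposite

/-- The ring homomorphism to the opposite of a quotient induced by an anti-endomorphism
compatible with the defining relation. -/
noncomputable def quotAnti {A : Type*} [Ring A] (r : A → A → Prop) (f : A →ₐ[ℤ] Aᵐᵒᵖ)
    (hf : ∀ ⦃x y⦄, r x y →
      RingQuot.mkAlgHom ℤ r (unop (f x)) = RingQuot.mkAlgHom ℤ r (unop (f y))) :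
    RingQuot r →ₐ[ℤ] (RingQuot r)ᵐᵒᵖ :=
  RingQuot.liftAlgHom ℤ ⟨(AlgHom.op (RingQuot.mkAlgHom ℤ r)).comp f, fun x y h =>
    show ((AlgHom.op (RingQuot.mkAlgHom ℤ r)).comp f) x =
      ((AlgHom.op (RingQuot.mkAlgHom ℤ r)).comp f) y from congrArg op (hf h)⟩

theorem quotAnti_mk {A : Type*} [Ring A] (r : A → A → Prop) (f : A →ₐ[ℤ] Aᵐᵒᵖ)
    (hf : ∀ ⦃x y⦄, r x y →
      RingQuot.mkAlgHom ℤ r (unop (f x)) = RingQuot.mkAlgHom ℤ r (unop (f y)))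
    (x : A) : quotAnti r f hf (RingQuot.mkAlgHom ℤ r x) =
      op (RingQuot.mkAlgHom ℤ r (unop (f x))) := by
  exact RingQuot.liftAlgHom_mkAlgHom_apply ℤ _ _ x

end Quotient

/-- For every Coxeter group `W` there is a `ℤ`-linear anti-automorphism
`x ↦ x̄` of `Ĥ(W)` with `s̄ᵢ = sᵢ`, `D̄ᵢ = Dᵢ`, which is an involution; it preserves the Hopf
ideal `J(W)` and hence induces an involutive anti-automorphism of `H̲(W) = Ĥ(W)/J(W)`
fixing the images of all `sᵢ` and `Dᵢ`. -/
theorem bar_antiinvolution {B : Type*} (M : CoxeterMatrix B)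
    (π : M.Group →* (HW M)ˣ)
    (hπ : ∀ i : B, ((π (M.toCoxeterSystem.simple i) : (HW M)ˣ) : HW M) = hs M i)
    (Dfam : Refl M → HW M)
    (hD1 : ∀ (i : B) (h : M.toCoxeterSystem.IsReflection (M.toCoxeterSystem.simple i)),
      Dfam ⟨M.toCoxeterSystem.simple i, h⟩ = hD M i)
    (hD2 : ∀ (i : B) (t : Refl M),
      (t : M.Group) ≠ M.toCoxeterSystem.simple i →
      ∀ h : M.toCoxeterSystem.IsReflection
          (M.toCoxeterSystem.simple i * (t : M.Group) * M.toCoxeterSystem.simple i),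
        hs M i * Dfam t * hs M i =
          Dfam ⟨M.toCoxeterSystem.simple i * (t : M.Group) * M.toCoxeterSystem.simple i, h⟩)
    (ε : HW M →ₐ[ℤ] ℤ)
    (hεs : ∀ i : B, ε (hs M i) = 1) (hεD : ∀ i : B, ε (hD M i) = 0) :
    ∃ φ : HW M ≃+ HW M,
      φ 1 = 1 ∧
      (∀ x y : HW M, φ (x * y) = φ y * φ x) ∧
      (∀ i : B, φ (hs M i) = hs M i) ∧
      (∀ i : B, φ (hD M i) = hD M i) ∧
      (∀ x : HW M, φ (φ x) = x) ∧
      (∀ x ∈ JW M π Dfam ε, φ x ∈ JW M π Dfam ε) ∧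
      ∃ ψ : HWlow M π Dfam ε ≃+ HWlow M π Dfam ε,
        (∀ x : HW M,
          ψ (RingQuot.mkAlgHom ℤ (lowRel M π Dfam ε) x) =
            RingQuot.mkAlgHom ℤ (lowRel M π Dfam ε) (φ x)) ∧
        ψ 1 = 1 ∧
        (∀ x y : HWlow M π Dfam ε, ψ (x * y) = ψ y * ψ x) ∧
        (∀ x : HWlow M π Dfam ε, ψ (ψ x) = x) ∧
        (∀ i : B, ψ (RingQuot.mkAlgHom ℤ (lowRel M π Dfam ε) (hs M i)) =
          RingQuot.mkAlgHom ℤ (lowRel M π Dfam ε) (hs M i)) ∧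
        (∀ i : B, ψ (RingQuot.mkAlgHom ℤ (lowRel M π Dfam ε) (hD M i)) =
          RingQuot.mkAlgHom ℤ (lowRel M π Dfam ε) (hD M i)) := by
  have hK : ∀ x ∈ KW M π Dfam, bar M x ∈ KW M π Dfam := fun x hx =>
    bar_mem_KW hπ (bar_reflection hD1 hD2) hx
  have hrel : ∀ ⦃x y⦄, lowRel M π Dfam ε x y →
      RingQuot.mkAlgHom ℤ (lowRel M π Dfam ε) (bar M x) =
        RingQuot.mkAlgHom ℤ (lowRel M π Dfam ε) (bar M y) := by
    rintro x y ⟨hx, hε, rfl⟩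
    refine RingQuot.mkAlgHom_rel ℤ ⟨hK x hx, ?_, map_zero _⟩
    rw [counit_bar, hε]
  set g := quotAnti (lowRel M π Dfam ε) (barHom M) hrel
  have hg (x : HW M) : (g (RingQuot.mkAlgHom ℤ (lowRel M π Dfam ε) x)).unop =
      RingQuot.mkAlgHom ℤ (lowRel M π Dfam ε) (bar M x) :=
    congrArg MulOpposite.unop (quotAnti_mk (lowRel M π Dfam ε) (barHom M) hrel x)
  have hgg (x : HWlow M π Dfam ε) : (g (g x).unop).unop = x := by
    obtain ⟨x, rfl⟩ := RingQuot.mkAlgHom_surjective ℤ (lowRel M π Dfam ε) x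
    rw [hg, hg, bar_bar]
  refine ⟨bar M, bar_one M, bar_mul M, bar_hs M, bar_hD M, bar_bar M,
    fun x hx => bar_mem_JW hK hx,
    { toFun := fun x => (g x).unop
      invFun := fun x => (g x).unop
      left_inv := hgg
      right_inv := hgg
      map_add' := fun x y => by simp }, hg, ?_, fun x y => ?_, hgg, fun i => ?_, fun i => ?_⟩
  · change (g 1).unop = 1
    simp
  · change (g (x * y)).unop = (g y).unop * (g x).unop
    simp
  · exact (hg _).trans (by rw [bar_hs])
  · exact (hg _).trans (by rw [bar_hD])

end HeckeHopfCox
end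

section
/- Let W be a group, S ⊆ W ∖ {1} a conjugation-invariant subset, R an integral domain, and χ, σ : W × S → R arbitrary functions. Let H' = H'_{χ,σ}(W) be the R-algebra presented by generators {g_w : w ∈ W} ∪ {D_s : s ∈ S} subject to: g_w·g_{w'} = g_{w w'} and g_1 = 1 for all w, w' ∈ W, and g_w·D_s·g_{w⁻¹} = χ(w,s)·D_{w s w⁻¹} + σ(w,s)·(1 − g_{w s w⁻¹}) for all w ∈ W, s ∈ S. Then: (a) H' is a Hopf algebra over R with comultiplication, counit, and antipode determined by Δ(g_w) = g_w ⊗ g_w, Δ(D_s) = D_s ⊗ 1 + g_s ⊗ D_s, ε(g_w) = 1, ε(D_s) = 0, S(g_w) = g_{w⁻¹}, S(D_s) = −g_{s⁻¹}·D_s; and (b) the R-linear map T(V) ⊗_R R[W] → H' sending x ⊗ w to ι(x)·g_w is bijective (where T(V) is the free R-algebra on the set S, R[W] the group algebra, and ι : T(V) → H' the algebra map sending the generator indexed by s to D_s) if and only if for all w₁, w₂ ∈ W and s ∈ S: χ(w₁w₂, s) = χ(w₂, s)·χ(w₁, w₂ s w₂⁻¹), every value χ(w,s) is a unit of R, and σ(w₁w₂,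 s) = σ(w₂, s) + χ(w₂, s)·σ(w₁, w₂ s w₂⁻¹). -/
open scoped TensorProduct

namespace GroupHopfEnvelope

/-- Generators of `H'_{χ,σ}(W)`: group elements `g_w` and `D_s` for `s ∈ S`. -/
inductive GGen (W : Type*) (S : Set W) : Type _
  | g : W → GGen W S
  | D : ↥S → GGen W S

variable {W : Type*} [Group W] {S : Set W} {R : Type*} [CommRing R]

noncomputable def fg (R : Type*) [CommRing R] {W : Type*} {S : Set W} (w : W) :
    FreeAlgebra R (GGen W S) := FreeAlgebra.ι R (GGen.g w)

noncomputable def fDg (R : Type*) [CommRing R] {W : Type*} {S : Set W} (s : ↥S) :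
    FreeAlgebra R (GGen W S) := FreeAlgebra.ι R (GGen.D s)

/-- The defining relations of `H'_{χ,σ}(W)`: `g_w·g_{w'} = g_{ww'}`, `g_1 = 1`, and
`g_w·D_s·g_{w⁻¹} = χ(w,s)·D_{w s w⁻¹} + σ(w,s)·(1 - g_{w s w⁻¹})`. -/
inductive GRel (W : Type*) [Group W] (S : Set W) (R : Type*) [CommRing R]
    (χ σ : W → ↥S → R) :
    FreeAlgebra R (GGen W S) → FreeAlgebra R (GGen W S) → Prop
  | mul (w w' : W) : GRel W S R χ σ (fg R w * fg R w') (fg R (w * w'))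
  | one : GRel W S R χ σ (fg R (1 : W)) 1
  | conj (w : W) (s : ↥S) (h : w * (s : W) * w⁻¹ ∈ S) :
      GRel W S R χ σ (fg R w * fDg R s * fg R w⁻¹)
        (χ w s • fDg R (⟨w * (s : W) * w⁻¹, h⟩ : ↥S) +
          σ w s • (1 - fg R (w * (s : W) * w⁻¹)))

/-- The algebra `H'_{χ,σ}(W)`. -/
abbrev HG (W : Type*) [Group W] (S : Set W) (R : Type*) [CommRing R]
    (χ σ : W → ↥S → R) : Type _ := RingQuot (GRel W S R χ σ)

/-- The image of `g_w` in `H'_{χ,σ}(W)`. -/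
noncomputable def gg (W : Type*) [Group W] (S : Set W) (R : Type*) [CommRing R]
    (χ σ : W → ↥S → R) (w : W) : HG W S R χ σ :=
  RingQuot.mkAlgHom R (GRel W S R χ σ) (fg R w)

/-- The image of `D_s` in `H'_{χ,σ}(W)`. -/
noncomputable def gD (W : Type*) [Group W] (S : Set W) (R : Type*) [CommRing R]
    (χ σ : W → ↥S → R) (s : ↥S) : HG W S R χ σ :=
  RingQuot.mkAlgHom R (GRel W S R χ σ) (fDg R s)

/-- A Hopf algebra structure on an `R`-algebra `A`: an algebra-homomorphism
comultiplication and counit and an anti-homomorphism antipode, satisfying the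
coassociativity, counit and antipode axioms. -/
structure HopfAlgStruct (R : Type*) (A : Type*) [CommRing R] [Ring A] [Algebra R A] where
  comul : A →ₐ[R] A ⊗[R] A
  counit : A →ₐ[R] R
  antipode : A →ₗ[R] A
  antipode_one : antipode 1 = 1
  antipode_mul : ∀ x y : A, antipode (x * y) = antipode y * antipode x
  coassoc : ∀ x : A,
    (TensorProduct.assoc R A A A) ((Algebra.TensorProduct.map comul (AlgHom.id R A)) (comul x)) =
      (Algebra.TensorProduct.map (AlgHom.id R A) comul) (comul x)
  counit_comul : ∀ x : A,
    (TensorProduct.lid R A) ((LinearMap.rTensor A counit.toLinearMap) (comul x)) = x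
  comul_counit : ∀ x : A,
    (TensorProduct.rid R A) ((LinearMap.lTensor A counit.toLinearMap) (comul x)) = x
  mul_antipode_rTensor_comul : ∀ x : A,
    (LinearMap.mul' R A) ((LinearMap.rTensor A antipode) (comul x)) = algebraMap R A (counit x)
  mul_antipode_lTensor_comul : ∀ x : A,
    (LinearMap.mul' R A) ((LinearMap.lTensor A antipode) (comul x)) = algebraMap R A (counit x)

section Presentation

variable {χ σ : W → ↥S → R}

lemma gg_mul (w w' : W) : gg W S R χ σ w * gg W S R χ σ w' = gg W S R χ σ (w * w') := by
  simpa [gg] using RingQuot.mkAlgHom_rel R (GRel.mul (χ := χ) (σ := σ) w w')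

lemma gg_one : gg W S R χ σ 1 = 1 := by
  simpa [gg] using RingQuot.mkAlgHom_rel R (GRel.one (χ := χ) (σ := σ))

lemma gg_conj (w : W) (s : ↥S) (h : w * (s : W) * w⁻¹ ∈ S) :
    gg W S R χ σ w * gD W S R χ σ s * gg W S R χ σ w⁻¹ =
      χ w s • gD W S R χ σ ⟨w * (s : W) * w⁻¹, h⟩ +
        σ w s • (1 - gg W S R χ σ (w * (s : W) * w⁻¹)) := by
  simpa [gg, gD] using RingQuot.mkAlgHom_rel R (GRel.conj (χ := χ) (σ := σ) w s h)

lemma gg_mul_gD (w : W) (s : ↥S) (h : w * (s : W) * w⁻¹ ∈ S) :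
    gg W S R χ σ w * gD W S R χ σ s =
      χ w s • (gD W S R χ σ ⟨w * (s : W) * w⁻¹, h⟩ * gg W S R χ σ w) +
        σ w s • (gg W S R χ σ w - gg W S R χ σ (w * s)) := by
  have := congrArg (· * gg W S R χ σ w) (gg_conj (χ := χ) (σ := σ) w s h)
  simpa [mul_assoc, gg_mul, gg_one, add_mul, sub_mul] using this

/-- Induction principle for `H'_{χ,σ}(W)`. -/
lemma HG.induction {motive : HG W S R χ σ → Prop}
    (algebraMap : ∀ r, motive (algebraMap R _ r))
    (gg : ∀ w, motive (gg W S R χ σ w)) (gD : ∀ s, motive (gD W S R χ σ s))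
    (mul : ∀ a b, motive a → motive b → motive (a * b))
    (add : ∀ a b, motive a → motive b → motive (a + b)) (a : HG W S R χ σ) : motive a := by
  obtain ⟨x, rfl⟩ := RingQuot.mkAlgHom_surjective R (GRel W S R χ σ) a
  induction x with
  | grade0 r => simpa using algebraMap r
  | grade1 x =>
    cases x with
    | g w => exact gg w
    | D s => exact gD s
  | mul a b ha hb => simpa using mul _ _ ha hb
  | add a b ha hb => simpa using add _ _ ha hb

lemma HG.algHom_ext {A : Type*} [Semiring A] [Algebra R A] {f f' : HG W S R χ σ →ₐ[R] A}
    (hg : ∀ w, f (gg W S R χ σ w) = f' (gg W S R χ σ w))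
    (hD : ∀ s, f (gD W S R χ σ s) = f' (gD W S R χ σ s)) : f = f' := by
  refine AlgHom.ext fun x => ?_
  induction x using HG.induction with
  | algebraMap r => simp
  | gg w => exact hg w
  | gD s => exact hD s
  | mul a b ha hb => simp [ha, hb]
  | add a b ha hb => simp [ha, hb]

/-- Universal property of `H'_{χ,σ}(W)`. -/
lemma HG.exists_algHom {A : Type*} [Ring A] [Algebra R A] (a : W → A) (d : ↥S → A)
    (hmul : ∀ w w', a w * a w' = a (w * w')) (hone : a 1 = 1)
    (hconj : ∀ (w : W) (s : ↥S) (h : w * (s : W) * w⁻¹ ∈ S), a w * d s * a w⁻¹ =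
      χ w s • d ⟨w * (s : W) * w⁻¹, h⟩ + σ w s • (1 - a (w * (s : W) * w⁻¹))) :
    ∃ f : HG W S R χ σ →ₐ[R] A,
      (∀ w, f (gg W S R χ σ w) = a w) ∧ ∀ s, f (gD W S R χ σ s) = d s := by
  let φ : FreeAlgebra R (GGen W S) →ₐ[R] A :=
    FreeAlgebra.lift R fun x => GGen.casesOn x a d
  have hg (w : W) : φ (fg R w) = a w := by simp [φ, fg]
  have hd (s : ↥S) : φ (fDg R s) = d s := by simp [φ, fDg]
  have hφ : ∀ ⦃x y⦄, GRel W S R χ σ x y → φ x = φ y := by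
    rintro _ _ (⟨w, w'⟩ | _ | ⟨w, s, h⟩)
    · simp [hg, hmul]
    · simp [hg, hone]
    · simp [hg, hd, hconj w s h]
  refine ⟨RingQuot.liftAlgHom R ⟨φ, hφ⟩, fun w => ?_, fun s => ?_⟩
  · rw [gg, RingQuot.liftAlgHom_mkAlgHom_apply, hg]
  · rw [gD, RingQuot.liftAlgHom_mkAlgHom_apply, hd]

lemma HG.mul_neg (x y : HG W S R χ σ) : x * -y = -(x * y) := _root_.mul_neg x y

lemma HG.neg_mul (x y : HG W S R χ σ) : -x * y = -(x * y) := _root_.neg_mul x y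

end Presentation

section Antipode

variable {A : Type*} [Ring A] [Algebra R A]

lemma mul'_rTensor_mul {f : A →ₗ[R] A} (hf : ∀ x y, f (x * y) = f y * f x)
    {z : A ⊗[R] A} {r : R} (hz : LinearMap.mul' R A (LinearMap.rTensor A f z) = algebraMap R A r)
    (z' : A ⊗[R] A) :
    LinearMap.mul' R A (LinearMap.rTensor A f (z * z')) =
      algebraMap R A r * LinearMap.mul' R A (LinearMap.rTensor A f z') := by
  induction z' with
  | zero => simp
  | add a b ha hb => simp only [mul_add, map_add, ha, hb]
  | tmul c d =>
    have key (z : A ⊗[R] A) : LinearMap.mul' R A (LinearMap.rTensor A f (z * c ⊗ₜ[R] d)) =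
        f c * LinearMap.mul' R A (LinearMap.rTensor A f z) * d := by
      induction z with
      | zero => simp
      | add a b ha hb => simp only [mul_add, add_mul, map_add, ha, hb]
      | tmul a b => simp [hf, mul_assoc]
    rw [key, hz, ← Algebra.commutes]
    simp [mul_assoc]

lemma mul'_lTensor_mul {f : A →ₗ[R] A} (hf : ∀ x y, f (x * y) = f y * f x)
    {z' : A ⊗[R] A} {r : R}
    (hz' : LinearMap.mul' R A (LinearMap.lTensor A f z') = algebraMap R A r) (z : A ⊗[R] A) :
    LinearMap.mul' R A (LinearMap.lTensor A f (z * z')) =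
      LinearMap.mul' R A (LinearMap.lTensor A f z) * algebraMap R A r := by
  induction z with
  | zero => simp
  | add a b ha hb => simp only [add_mul, map_add, ha, hb]
  | tmul c d =>
    have key (z : A ⊗[R] A) : LinearMap.mul' R A (LinearMap.lTensor A f (c ⊗ₜ[R] d * z)) =
        c * LinearMap.mul' R A (LinearMap.lTensor A f z) * f d := by
      induction z with
      | zero => simp
      | add a b ha hb => simp only [mul_add, add_mul, map_add, ha, hb]
      | tmul a b => simp [hf, mul_assoc]
    rw [key, hz', mul_assoc, Algebra.commutes]
    simp [mul_assoc]

end Antipode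

section Hopf

variable (χ σ : W → ↥S → R)

lemma skew_tmul_of_eq {A : Type*} [Ring A] [Algebra R A] {x d g : A} {a b : R}
    (h : x = a • d + b • (1 - g)) :
    x ⊗ₜ[R] (1 : A) + g ⊗ₜ[R] x = a • (d ⊗ₜ[R] 1 + g ⊗ₜ[R] d) + b • (1 - g ⊗ₜ[R] g) := by
  simp only [h, TensorProduct.add_tmul, TensorProduct.tmul_add, ← TensorProduct.smul_tmul',
    TensorProduct.tmul_smul, TensorProduct.sub_tmul, TensorProduct.tmul_sub,
    Algebra.TensorProduct.one_def]
  module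

lemma exists_comul : ∃ Δ : HG W S R χ σ →ₐ[R] HG W S R χ σ ⊗[R] HG W S R χ σ,
    (∀ w, Δ (gg W S R χ σ w) = gg W S R χ σ w ⊗ₜ[R] gg W S R χ σ w) ∧
    ∀ s : ↥S, Δ (gD W S R χ σ s) =
      gD W S R χ σ s ⊗ₜ[R] 1 + gg W S R χ σ (s : W) ⊗ₜ[R] gD W S R χ σ s := by
  refine HG.exists_algHom (fun w => gg W S R χ σ w ⊗ₜ[R] gg W S R χ σ w)
    (fun s => gD W S R χ σ s ⊗ₜ[R] 1 + gg W S R χ σ (s : W) ⊗ₜ[R] gD W S R χ σ s)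
    (fun w w' => ?_) ?_ fun w s h => ?_
  · simp [gg_mul]
  · simp [gg_one, Algebra.TensorProduct.one_def]
  · refine Eq.trans ?_ (skew_tmul_of_eq (gg_conj w s h))
    simp [mul_add, add_mul, gg_mul, gg_one]

lemma exists_counit : ∃ ε : HG W S R χ σ →ₐ[R] R,
    (∀ w, ε (gg W S R χ σ w) = 1) ∧ ∀ s : ↥S, ε (gD W S R χ σ s) = 0 :=
  HG.exists_algHom (fun _ => 1) (fun _ => 0) (by simp) rfl (by simp)

lemma exists_antipode : ∃ f : HG W S R χ σ →ₐ[R] (HG W S R χ σ)ᵐᵒᵖ,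
    (∀ w, f (gg W S R χ σ w) = .op (gg W S R χ σ w⁻¹)) ∧
    ∀ s : ↥S, f (gD W S R χ σ s) = .op (-(gg W S R χ σ (s : W)⁻¹ * gD W S R χ σ s)) := by
  refine HG.exists_algHom _ _ (fun w w' => ?_) ?_ fun w s h => MulOpposite.unop_injective ?_
  · rw [← MulOpposite.op_mul, gg_mul, mul_inv_rev]
  · simp [gg_one]
  · have key : gg W S R χ σ w * (gg W S R χ σ (s : W)⁻¹ * (gD W S R χ σ s * gg W S R χ σ w⁻¹)) =
        gg W S R χ σ (w * (s : W) * w⁻¹)⁻¹ *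
          (gg W S R χ σ w * gD W S R χ σ s * gg W S R χ σ w⁻¹) := by
      simp only [← mul_assoc, gg_mul]
      congr 3
      group
    simp only [MulOpposite.unop_mul, MulOpposite.unop_op, MulOpposite.unop_add,
      MulOpposite.unop_smul, MulOpposite.unop_sub, MulOpposite.unop_one, inv_inv, HG.neg_mul,
      HG.mul_neg, mul_assoc] at key ⊢
    rw [key, ← mul_assoc (gg W S R χ σ w), gg_conj w s h]
    simp only [mul_add, mul_smul_comm, mul_sub, mul_one, gg_mul, mul_assoc]
    have : gg W S R χ σ ((w * ((s : W) * w⁻¹))⁻¹ * (w * ((s : W) * w⁻¹))) = 1 := by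
      simp [gg_one]
    rw [this]
    module

theorem exists_hopfAlgStruct : ∃ Hst : HopfAlgStruct R (HG W S R χ σ),
      (∀ w : W, Hst.comul (gg W S R χ σ w) = gg W S R χ σ w ⊗ₜ[R] gg W S R χ σ w) ∧
      (∀ s : ↥S, Hst.comul (gD W S R χ σ s) =
        gD W S R χ σ s ⊗ₜ[R] 1 + gg W S R χ σ (s : W) ⊗ₜ[R] gD W S R χ σ s) ∧
      (∀ w : W, Hst.counit (gg W S R χ σ w) = 1) ∧
      (∀ s : ↥S, Hst.counit (gD W S R χ σ s) = 0) ∧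
      (∀ w : W, Hst.antipode (gg W S R χ σ w) = gg W S R χ σ w⁻¹) ∧
      (∀ s : ↥S, Hst.antipode (gD W S R χ σ s) =
        -(gg W S R χ σ ((s : W)⁻¹) * gD W S R χ σ s)) := by
  obtain ⟨Δ, hΔg, hΔD⟩ := exists_comul χ σ
  obtain ⟨ε, hεg, hεD⟩ := exists_counit χ σ
  obtain ⟨f, hfg, hfD⟩ := exists_antipode χ σ
  let α : HG W S R χ σ →ₗ[R] HG W S R χ σ :=
    (MulOpposite.opLinearEquiv R).symm.toLinearMap ∘ₗ f.toLinearMap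
  have hα (x : HG W S R χ σ) : α x = (f x).unop := rfl
  have hαg (w : W) : α (gg W S R χ σ w) = gg W S R χ σ w⁻¹ := by simp [hα, hfg]
  have hαD (s : ↥S) : α (gD W S R χ σ s) = -(gg W S R χ σ (s : W)⁻¹ * gD W S R χ σ s) := by
    simp [hα, hfD]
  have hα1 : α 1 = 1 := by simp [hα]
  have hαmul (x y : HG W S R χ σ) : α (x * y) = α y * α x := by simp [hα]
  have coassoc : (Algebra.TensorProduct.assoc R R R _ _ _).toAlgHom.comp
      ((Algebra.TensorProduct.map Δ (.id R _)).comp Δ) =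
      (Algebra.TensorProduct.map (.id R _) Δ).comp Δ := by
    refine HG.algHom_ext (fun w => ?_) fun s => ?_
    · simp [hΔg]
    · simp [hΔD, hΔg, TensorProduct.add_tmul, TensorProduct.tmul_add,
        Algebra.TensorProduct.one_def, add_assoc]
  have counit_left : (Algebra.TensorProduct.lid R _).toAlgHom.comp
      ((Algebra.TensorProduct.map ε (.id R _)).comp Δ) = .id R _ := by
    refine HG.algHom_ext (fun w => ?_) fun s => ?_
    · simp [hΔg, hεg]
    · simp [hΔD, hεD, hεg]
  have counit_right : (Algebra.TensorProduct.rid R R _).toAlgHom.comp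
      ((Algebra.TensorProduct.map (.id R _) ε).comp Δ) = .id R _ := by
    refine HG.algHom_ext (fun w => ?_) fun s => ?_
    · simp [hΔg, hεg]
    · simp [hΔD, hεD]
  refine ⟨⟨Δ, ε, α, hα1, hαmul, fun x => DFunLike.congr_fun coassoc x,
    fun x => DFunLike.congr_fun counit_left x, fun x => DFunLike.congr_fun counit_right x,
    fun x => ?_, fun x => ?_⟩, hΔg, hΔD, hεg, hεD, hαg, hαD⟩
  · induction x using HG.induction with
    | algebraMap r => simp [Algebra.algebraMap_eq_smul_one, Algebra.TensorProduct.one_def, hα1]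
    | gg w => simp [hΔg, hεg, hαg, gg_mul, gg_one]
    | gD s => simp [hΔD, hεD, hαD, hαg]
    | mul a b ha hb => rw [map_mul, mul'_rTensor_mul hαmul ha, hb, map_mul, map_mul]
    | add a b ha hb => simp only [map_add, ha, hb]
  · induction x using HG.induction with
    | algebraMap r => simp [Algebra.algebraMap_eq_smul_one, Algebra.TensorProduct.one_def, hα1]
    | gg w => simp [hΔg, hεg, hαg, gg_mul, gg_one]
    | gD s => simp [hΔD, hεD, hαD, hα1, HG.mul_neg, ← mul_assoc, gg_mul, gg_one]
    | mul a b ha hb => rw [map_mul, mul'_lTensor_mul hαmul hb, ha, map_mul, map_mul]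
    | add a b ha hb => simp only [map_add, ha, hb]

end Hopf

section Normal

lemma submodule_eq_top_of_stable {N : Submodule R (FreeAlgebra R ↥S ⊗[R] MonoidAlgebra R W)}
    (hof : ∀ w, 1 ⊗ₜ[R] MonoidAlgebra.of R W w ∈ N)
    (hι : ∀ s, ∀ t ∈ N, FreeAlgebra.ι R s ⊗ₜ[R] 1 * t ∈ N) : N = ⊤ := by
  have hmul (x : FreeAlgebra R ↥S) : ∀ t ∈ N, x ⊗ₜ[R] 1 * t ∈ N := by
    induction x with
    | grade0 r =>
      intro t ht
      rw [Algebra.algebraMap_eq_smul_one, ← TensorProduct.smul_tmul',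
        ← Algebra.TensorProduct.one_def, smul_mul_assoc, one_mul]
      exact N.smul_mem r ht
    | grade1 s => exact hι s
    | mul a b ha hb =>
      intro t ht
      have := ha _ (hb t ht)
      rwa [← mul_assoc, Algebra.TensorProduct.tmul_mul_tmul, one_mul] at this
    | add a b ha hb =>
      intro t ht
      rw [TensorProduct.add_tmul, add_mul]
      exact N.add_mem (ha t ht) (hb t ht)
  have hone (f : MonoidAlgebra R W) : 1 ⊗ₜ[R] f ∈ N := by
    induction f using MonoidAlgebra.induction_on with
    | of w => exact hof w
    | add f g hf hg => rw [TensorProduct.tmul_add]; exact N.add_mem hf hg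
    | smul r f hf => rw [TensorProduct.tmul_smul]; exact N.smul_mem r hf
  rw [eq_top_iff]
  rintro t -
  induction t with
  | zero => exact N.zero_mem
  | add a b ha hb => exact N.add_mem ha hb
  | tmul x f => simpa using hmul x _ (hone f)

variable (hS : ∀ (w s : W), s ∈ S → w * s * w⁻¹ ∈ S) (χ σ : W → ↥S → R)

/-- The element `w s w⁻¹` of `S`. -/
def conjS (w : W) (s : ↥S) : ↥S := ⟨w * s * w⁻¹, hS w s s.2⟩

/-- The effect of left multiplication by a generator `D_s` on the family of all
left translates `(g_w t)_w` of an element `t`. -/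
noncomputable def twistGen (s : ↥S) :
    Module.End R (W → FreeAlgebra R ↥S ⊗[R] MonoidAlgebra R W) where
  toFun F w := χ w s • (FreeAlgebra.ι R (conjS hS w s) ⊗ₜ[R] 1 * F w) +
    σ w s • (F w - F (w * (s : W)))
  map_add' F F' := by
    ext w : 1
    simp only [Pi.add_apply, mul_add]
    module
  map_smul' r F := by
    ext w : 1
    simp only [Pi.smul_apply, mul_smul_comm, RingHom.id_apply]
    module

/-- The left action of `g_w` on the normal forms `T(V) ⊗ R[W]`. -/
noncomputable def gAct (w : W) :
    Module.End R (FreeAlgebra R ↥S ⊗[R] MonoidAlgebra R W) :=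
  TensorProduct.lift <| LinearMap.mk₂ R
    (fun x f => FreeAlgebra.lift R (twistGen hS χ σ) x
      (fun v => 1 ⊗ₜ[R] (MonoidAlgebra.of R W v * f)) w)
    (by simp) (by simp)
    (fun x f f' => by
      simp only [mul_add, TensorProduct.tmul_add]
      exact congrFun (map_add (FreeAlgebra.lift R (twistGen hS χ σ) x) _ _) w)
    (fun r x f => by
      simp only [mul_smul_comm, TensorProduct.tmul_smul]
      exact congrFun (map_smul (FreeAlgebra.lift R (twistGen hS χ σ) x) r _) w)

lemma gAct_one_tmul (w v : W) :
    gAct hS χ σ w (1 ⊗ₜ[R] MonoidAlgebra.of R W v) = 1 ⊗ₜ[R] MonoidAlgebra.of R W (w * v) := by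
  simp [gAct]

lemma gAct_ι_mul (w : W) (s : ↥S) (t : FreeAlgebra R ↥S ⊗[R] MonoidAlgebra R W) :
    gAct hS χ σ w (FreeAlgebra.ι R s ⊗ₜ[R] 1 * t) =
      χ w s • (FreeAlgebra.ι R (conjS hS w s) ⊗ₜ[R] 1 * gAct hS χ σ w t) +
        σ w s • (gAct hS χ σ w t - gAct hS χ σ (w * s) t) := by
  induction t with
  | zero => simp
  | add a b ha hb => simp only [mul_add, map_add, ha, hb]; module
  | tmul x f => simp [gAct, twistGen]

variable {χ σ}

lemma gAct_gAct
    (hχ : ∀ w₁ w₂ s, χ (w₁ * w₂) s = χ w₂ s * χ w₁ (conjS hS w₂ s))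
    (hσ : ∀ w₁ w₂ s, σ (w₁ * w₂) s = σ w₂ s + χ w₂ s * σ w₁ (conjS hS w₂ s))
    (w₁ w₂ : W) (t : FreeAlgebra R ↥S ⊗[R] MonoidAlgebra R W) :
    gAct hS χ σ w₁ (gAct hS χ σ w₂ t) = gAct hS χ σ (w₁ * w₂) t := by
  let N : Submodule R (FreeAlgebra R ↥S ⊗[R] MonoidAlgebra R W) :=
    ⨅ w₁, ⨅ w₂, LinearMap.eqLocus (gAct hS χ σ w₁ ∘ₗ gAct hS χ σ w₂) (gAct hS χ σ (w₁ * w₂))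
  have hN {t} : t ∈ N ↔ ∀ w₁ w₂, gAct hS χ σ w₁ (gAct hS χ σ w₂ t) = gAct hS χ σ (w₁ * w₂) t := by
    simp [N]
  suffices N = ⊤ from hN.1 (this ▸ Submodule.mem_top) w₁ w₂
  refine submodule_eq_top_of_stable (fun v => hN.2 fun w₁ w₂ => ?_)
    fun s t ht => hN.2 fun w₁ w₂ => ?_
  · simp only [gAct_one_tmul, mul_assoc]
  · have h1 : conjS hS w₁ (conjS hS w₂ s) = conjS hS (w₁ * w₂) s := by
      simp [conjS, mul_assoc]
    have h2 : w₁ * (conjS hS w₂ s : W) * w₂ = w₁ * w₂ * s := by simp [conjS, mul_assoc]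
    simp only [gAct_ι_mul, map_add, map_smul, map_sub, hN.1 ht, hχ w₁ w₂, hσ w₁ w₂, h1, h2,
      ← mul_assoc]
    module

lemma cocycle_one (hχ : ∀ w₁ w₂ s, χ (w₁ * w₂) s = χ w₂ s * χ w₁ (conjS hS w₂ s))
    (hu : ∀ w s, IsUnit (χ w s))
    (hσ : ∀ w₁ w₂ s, σ (w₁ * w₂) s = σ w₂ s + χ w₂ s * σ w₁ (conjS hS w₂ s)) (s : ↥S) :
    χ 1 s = 1 ∧ σ 1 s = 0 := by
  have h1 : conjS hS 1 s = s := by simp [conjS]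
  have hχ1 := hχ 1 1 s
  have hσ1 := hσ 1 1 s
  rw [h1, mul_one] at hχ1 hσ1
  have : χ 1 s = 1 := (hu 1 s).mul_left_cancel (by rw [← hχ1, mul_one])
  exact ⟨this, by simpa [this] using hσ1⟩

lemma gAct_one (h1 : ∀ s, χ 1 s = 1 ∧ σ 1 s = 0) : gAct hS χ σ 1 = 1 := by
  suffices LinearMap.eqLocus (gAct hS χ σ 1) 1 = ⊤ from LinearMap.eqLocus_eq_top.1 this
  refine submodule_eq_top_of_stable (fun v => ?_) fun s t ht => ?_
  · rw [LinearMap.mem_eqLocus, gAct_one_tmul, one_mul, Module.End.one_apply]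
  · rw [LinearMap.mem_eqLocus, Module.End.one_apply] at ht ⊢
    simp [gAct_ι_mul, h1, ht, conjS]

variable (χ σ)

/-- The multiplication map `T(V) ⊗ R[W] → H'`, `x ⊗ w ↦ ι(x)·g_w`. -/
noncomputable def normalMap :
    FreeAlgebra R ↥S ⊗[R] MonoidAlgebra R W →ₗ[R] HG W S R χ σ :=
  LinearMap.mul' R _ ∘ₗ TensorProduct.map
    (FreeAlgebra.lift R fun s : ↥S => gD W S R χ σ s).toLinearMap
    (MonoidAlgebra.lift R (HG W S R χ σ) W
      { toFun := gg W S R χ σ, map_one' := gg_one,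
        map_mul' := fun w w' => (gg_mul w w').symm }).toLinearMap

lemma normalMap_tmul_of (x : FreeAlgebra R ↥S) (w : W) :
    normalMap χ σ (x ⊗ₜ[R] MonoidAlgebra.of R W w) =
      FreeAlgebra.lift R (fun s : ↥S => gD W S R χ σ s) x * gg W S R χ σ w := by
  simp [normalMap]

lemma normalMap_ι_mul (s : ↥S) (t : FreeAlgebra R ↥S ⊗[R] MonoidAlgebra R W) :
    normalMap χ σ (FreeAlgebra.ι R s ⊗ₜ[R] 1 * t) = gD W S R χ σ s * normalMap χ σ t := by
  induction t with
  | zero => simp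
  | add a b ha hb => simp only [mul_add, map_add, ha, hb]
  | tmul x f => simp [normalMap, mul_assoc]

lemma normalMap_gAct (w : W) (t : FreeAlgebra R ↥S ⊗[R] MonoidAlgebra R W) :
    normalMap χ σ (gAct hS χ σ w t) = gg W S R χ σ w * normalMap χ σ t := by
  let N : Submodule R (FreeAlgebra R ↥S ⊗[R] MonoidAlgebra R W) :=
    ⨅ w, LinearMap.eqLocus (normalMap χ σ ∘ₗ gAct hS χ σ w)
      (LinearMap.mulLeft R (gg W S R χ σ w) ∘ₗ normalMap χ σ)
  have hN {t} : t ∈ N ↔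
      ∀ w, normalMap χ σ (gAct hS χ σ w t) = gg W S R χ σ w * normalMap χ σ t := by
    simp [N]
  suffices N = ⊤ from hN.1 (this ▸ Submodule.mem_top) w
  refine submodule_eq_top_of_stable (fun v => hN.2 fun w => ?_) fun s t ht => hN.2 fun w => ?_
  · rw [gAct_one_tmul, normalMap_tmul_of, normalMap_tmul_of, map_one, one_mul, one_mul, gg_mul]
  · simp only [gAct_ι_mul, map_add, map_smul, map_sub, hN.1 ht, normalMap_ι_mul, ← mul_assoc,
      gg_mul_gD w s (hS w s s.2), add_mul, sub_mul, smul_mul_assoc]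
    rfl

variable {χ σ}

theorem normalMap_bijective
    (hχ : ∀ w₁ w₂ s, χ (w₁ * w₂) s = χ w₂ s * χ w₁ (conjS hS w₂ s))
    (hu : ∀ w s, IsUnit (χ w s))
    (hσ : ∀ w₁ w₂ s, σ (w₁ * w₂) s = σ w₂ s + χ w₂ s * σ w₁ (conjS hS w₂ s)) :
    Function.Bijective (normalMap χ σ) := by
  obtain ⟨Φ, hΦg, hΦD⟩ := HG.exists_algHom (χ := χ) (σ := σ) (gAct hS χ σ)
    (fun s => LinearMap.mulLeft R (FreeAlgebra.ι R s ⊗ₜ[R] 1))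
    (fun w w' => LinearMap.ext fun t => gAct_gAct hS hχ hσ w w' t)
    (gAct_one hS (cocycle_one hS hχ hu hσ)) (fun w s h => by
      refine LinearMap.ext fun t => ?_
      have h1 := gAct_one hS (cocycle_one hS hχ hu hσ)
      simp [gAct_ι_mul, gAct_gAct hS hχ hσ, h1, conjS])
  have hΦ (x : FreeAlgebra R ↥S) (t : FreeAlgebra R ↥S ⊗[R] MonoidAlgebra R W) :
      Φ (FreeAlgebra.lift R (fun s : ↥S => gD W S R χ σ s) x) t = x ⊗ₜ[R] 1 * t := by
    have : Φ.comp (FreeAlgebra.lift R fun s : ↥S => gD W S R χ σ s) =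
        (Algebra.lmul R _).comp Algebra.TensorProduct.includeLeft := by
      ext s : 2
      simp only [AlgHom.comp_apply, Function.comp_apply, FreeAlgebra.lift_ι_apply, hΦD]
      rfl
    exact LinearMap.congr_fun (DFunLike.congr_fun this x) t
  have intertwine (h : HG W S R χ σ) (t : FreeAlgebra R ↥S ⊗[R] MonoidAlgebra R W) :
      normalMap χ σ (Φ h t) = h * normalMap χ σ t := by
    induction h using HG.induction generalizing t with
    | algebraMap r => simp [Algebra.smul_def]
    | gg w => rw [hΦg, normalMap_gAct]
    | gD s => rw [hΦD, LinearMap.mulLeft_apply, normalMap_ι_mul]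
    | mul a b ha hb => rw [map_mul, Module.End.mul_apply, ha, hb, mul_assoc]
    | add a b ha hb => rw [map_add, LinearMap.add_apply, map_add, ha, hb, add_mul]
  have left_inv (t : FreeAlgebra R ↥S ⊗[R] MonoidAlgebra R W) :
      Φ (normalMap χ σ t) (1 ⊗ₜ[R] MonoidAlgebra.of R W 1) = t := by
    induction t with
    | zero => simp
    | add a b ha hb => simp only [map_add, LinearMap.add_apply, ha, hb]
    | tmul x f =>
      induction f using MonoidAlgebra.induction_on with
      | of w =>
        rw [normalMap_tmul_of, map_mul, Module.End.mul_apply, hΦg, gAct_one_tmul, hΦ]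
        simp
      | add f g hf hg => simp only [TensorProduct.tmul_add, map_add, LinearMap.add_apply, hf, hg]
      | smul r f hf => simp only [TensorProduct.tmul_smul, map_smul, LinearMap.smul_apply, hf]
  refine ⟨fun t t' e => by rw [← left_inv t, e, left_inv],
    fun h => ⟨Φ h (1 ⊗ₜ[R] MonoidAlgebra.of R W 1), ?_⟩⟩
  rw [intertwine, normalMap_tmul_of, gg_one]
  simp

lemma coeff_eq_of_normal_form_eq (h1 : (1 : W) ∉ S) {s : ↥S} {a b a' b' : R}
    (h : a • (FreeAlgebra.ι R s ⊗ₜ[R] MonoidAlgebra.of R W 1) +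
        b • (1 ⊗ₜ[R] MonoidAlgebra.of R W 1 - 1 ⊗ₜ[R] MonoidAlgebra.of R W (s : W)) =
      a' • (FreeAlgebra.ι R s ⊗ₜ[R] MonoidAlgebra.of R W 1) +
        b' • ((1 : FreeAlgebra R ↥S) ⊗ₜ[R] MonoidAlgebra.of R W 1 -
          1 ⊗ₜ[R] MonoidAlgebra.of R W (s : W))) : a = a' ∧ b = b' := by
  have hs : (s : W) ≠ 1 := fun e => h1 (e ▸ s.2)
  let c : MonoidAlgebra R W →ₗ[R] R :=
    Finsupp.lapply 1 ∘ₗ (MonoidAlgebra.coeffLinearEquiv R).toLinearMap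
  have hc1 : c 1 = 1 := by simp [c, MonoidAlgebra.one_def]
  have hcs : c (MonoidAlgebra.of R W (s : W)) = 0 := by simp [c, hs]
  let p (r : R) : FreeAlgebra R ↥S ⊗[R] MonoidAlgebra R W →ₗ[R] R :=
    LinearMap.mul' R R ∘ₗ
      TensorProduct.map (FreeAlgebra.lift R fun _ : ↥S => r).toLinearMap c
  have hp (r : R) := congrArg (p r) h
  simp only [p, map_add, map_sub, map_smul, LinearMap.comp_apply, TensorProduct.map_tmul,
    AlgHom.toLinearMap_apply, FreeAlgebra.lift_ι_apply, map_one, hc1, hcs,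
    LinearMap.mul'_apply, smul_eq_mul, mul_one, mul_zero, sub_zero] at hp
  have hb : b = b' := by simpa using hp 0
  exact ⟨by simpa [hb] using hp 1, hb⟩

theorem cocycle_of_injective (h1 : (1 : W) ∉ S)
    {μ : FreeAlgebra R ↥S ⊗[R] MonoidAlgebra R W →ₗ[R] HG W S R χ σ}
    (hμ : ∀ (x : FreeAlgebra R ↥S) (w : W), μ (x ⊗ₜ[R] MonoidAlgebra.of R W w) =
      FreeAlgebra.lift R (fun s : ↥S => gD W S R χ σ s) x * gg W S R χ σ w)
    (hinj : Function.Injective μ) :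
    (∀ w₁ w₂ s, χ (w₁ * w₂) s = χ w₂ s * χ w₁ (conjS hS w₂ s)) ∧
    (∀ w s, IsUnit (χ w s)) ∧
    ∀ w₁ w₂ s, σ (w₁ * w₂) s = σ w₂ s + χ w₂ s * σ w₁ (conjS hS w₂ s) := by
  have coeff_eq {s : ↥S} {a b a' b' : R}
      (h : a • gD W S R χ σ s + b • (1 - gg W S R χ σ (s : W)) =
        a' • gD W S R χ σ s + b' • (1 - gg W S R χ σ (s : W))) : a = a' ∧ b = b' := by
    refine coeff_eq_of_normal_form_eq (s := s) h1 (hinj ?_)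
    simp only [map_add, map_sub, map_smul, hμ]
    simpa only [FreeAlgebra.lift_ι_apply, map_one, gg_one, mul_one,
      one_mul] using h
  have conj (w : W) (s : ↥S) : gg W S R χ σ w * gD W S R χ σ s * gg W S R χ σ w⁻¹ =
      χ w s • gD W S R χ σ (conjS hS w s) + σ w s • (1 - gg W S R χ σ (conjS hS w s : W)) :=
    gg_conj w s _
  have hone (s : ↥S) : χ 1 s = 1 := by
    have e : conjS hS 1 s = s := by simp [conjS]
    have := conj 1 s
    rw [e] at this
    refine (coeff_eq (s := s) (b := σ 1 s) (b' := 0) ?_).1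
    rw [← this]
    simp [gg_one]
  have both (w₁ w₂ : W) (s : ↥S) : χ (w₁ * w₂) s = χ w₂ s * χ w₁ (conjS hS w₂ s) ∧
      σ (w₁ * w₂) s = σ w₂ s + χ w₂ s * σ w₁ (conjS hS w₂ s) := by
    have e : conjS hS w₁ (conjS hS w₂ s) = conjS hS (w₁ * w₂) s := by simp [conjS, mul_assoc]
    have eg : gg W S R χ σ w₁ * gg W S R χ σ (conjS hS w₂ s : W) * gg W S R χ σ w₁⁻¹ =
        gg W S R χ σ (conjS hS (w₁ * w₂) s : W) := by
      simp [gg_mul, conjS, mul_assoc]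
    refine coeff_eq (s := conjS hS (w₁ * w₂) s) ?_
    calc
      _ = gg W S R χ σ w₁ * (gg W S R χ σ w₂ * gD W S R χ σ s * gg W S R χ σ w₂⁻¹) *
          gg W S R χ σ w₁⁻¹ := by
        rw [← conj, mul_inv_rev, ← gg_mul, ← gg_mul]
        simp only [mul_assoc]
      _ = χ w₂ s • (gg W S R χ σ w₁ * gD W S R χ σ (conjS hS w₂ s) * gg W S R χ σ w₁⁻¹) +
          σ w₂ s • (1 - gg W S R χ σ (conjS hS (w₁ * w₂) s : W)) := by
        rw [conj, ← eg]
        simp [mul_add, add_mul, mul_sub, sub_mul, gg_mul, gg_one]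
      _ = _ := by
        rw [conj, e]
        module
  refine ⟨fun w₁ w₂ s => (both w₁ w₂ s).1, fun w s => ?_, fun w₁ w₂ s => (both w₁ w₂ s).2⟩
  refine IsUnit.of_mul_eq_one (χ w⁻¹ (conjS hS w s)) ?_
  rw [← (both w⁻¹ w s).1, inv_mul_cancel, hone]

end Normal

/-- Let `W` be a group, `S ⊆ W ∖ {1}` conjugation-invariant, `R` an
integral domain and `χ, σ : W × S → R` arbitrary.  Then (a) `H' = H'_{χ,σ}(W)` is a Hopf
algebra over `R` with `Δ(g_w) = g_w ⊗ g_w`, `Δ(D_s) = D_s ⊗ 1 + g_s ⊗ D_s`, `ε(g_w) = 1`,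
`ε(D_s) = 0`, `S(g_w) = g_{w⁻¹}`, `S(D_s) = -g_{s⁻¹}·D_s`; and (b) the `R`-linear map
`T(V) ⊗_R R[W] → H'`, `x ⊗ w ↦ ι(x)·g_w`, is bijective if and only if `χ` and `σ` satisfy
the cocycle conditions `(2.2)` and all values of `χ` are units. -/
theorem hopf_envelope_of_group
    (W : Type*) [Group W] (S : Set W) (R : Type*) [CommRing R] [IsDomain R]
    (hS1 : (1 : W) ∉ S)
    (hSconj : ∀ (w s : W), s ∈ S → w * s * w⁻¹ ∈ S)
    (χ σ : W → ↥S → R) :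
    (∃ Hst : HopfAlgStruct R (HG W S R χ σ),
      (∀ w : W, Hst.comul (gg W S R χ σ w) = gg W S R χ σ w ⊗ₜ[R] gg W S R χ σ w) ∧
      (∀ s : ↥S, Hst.comul (gD W S R χ σ s) =
        gD W S R χ σ s ⊗ₜ[R] 1 + gg W S R χ σ (s : W) ⊗ₜ[R] gD W S R χ σ s) ∧
      (∀ w : W, Hst.counit (gg W S R χ σ w) = 1) ∧
      (∀ s : ↥S, Hst.counit (gD W S R χ σ s) = 0) ∧
      (∀ w : W, Hst.antipode (gg W S R χ σ w) = gg W S R χ σ w⁻¹) ∧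
      (∀ s : ↥S, Hst.antipode (gD W S R χ σ s) =
        -(gg W S R χ σ ((s : W)⁻¹) * gD W S R χ σ s))) ∧
    ((∃ μ : (FreeAlgebra R ↥S) ⊗[R] (MonoidAlgebra R W) →ₗ[R] HG W S R χ σ,
        (∀ (x : FreeAlgebra R ↥S) (w : W),
          μ (x ⊗ₜ[R] (MonoidAlgebra.of R W w)) =
            (FreeAlgebra.lift R (fun s : ↥S => gD W S R χ σ s) x) * gg W S R χ σ w) ∧
        Function.Bijective μ) ↔
      ((∀ (w₁ w₂ : W) (s : ↥S),
          χ (w₁ * w₂) s =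
            χ w₂ s * χ w₁ (⟨w₂ * (s : W) * w₂⁻¹, hSconj w₂ s s.2⟩ : ↥S)) ∧
       (∀ (w : W) (s : ↥S), IsUnit (χ w s)) ∧
       (∀ (w₁ w₂ : W) (s : ↥S),
          σ (w₁ * w₂) s =
            σ w₂ s + χ w₂ s * σ w₁ (⟨w₂ * (s : W) * w₂⁻¹, hSconj w₂ s s.2⟩ : ↥S)))) := by
  refine ⟨exists_hopfAlgStruct χ σ, ?_, ?_⟩
  · rintro ⟨μ, hμ, hbij⟩
    exact cocycle_of_injective hSconj hS1 hμ hbij.injective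
  · rintro ⟨hχ, hu, hσ⟩
    exact ⟨normalMap χ σ, normalMap_tmul_of χ σ, normalMap_bijective hSconj hχ hu hσ⟩

end GroupHopfEnvelope
end
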